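/- Let (T, μ, η) be a Hopf monad on a category 𝕏 with finite biproducts, with fusion invertor h°. Then the following are equivalent: (i) (T, μ, η) is an idempotent monad; (ii) T preserves zero maps, i.e. T(0) = 0 for every zero map 0; (iii) the fusion invertor is of the form h°_A = T(ι₁) for every object A, where ι₁ : A → A ⊕ T(𝟘). -/

import Mathlib

/-!
Hopf monads on a category with finite biproducts (Bruguières–Lack–Virelizier style),
following "Hopf Monads on Biproducts".

Setting: `C` is a category with a zero object and binary biproducts (hence zero
morphisms), so that each hom-set carries the commutative monoid structure induced by
the biproducts.  `badd f g` is the induced addition of parallel maps.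
-/

namespace HopfBiproducts

open CategoryTheory CategoryTheory.Limits ZeroObject

universe v u

variable {C : Type u} [Category.{v} C] [HasZeroObject C] [HasZeroMorphisms C]
  [HasBinaryBiproducts C]

/-- The addition of parallel maps induced by binary biproducts:
`f + g = ⟨f, g⟩ ≫ [1, 1]`. -/
noncomputable def badd {X Y : C} (f g : X ⟶ Y) : X ⟶ Y :=
  biprod.lift f g ≫ biprod.desc (𝟙 Y) (𝟙 Y)

/-- The fusion operator `h_{A,B} = ι₁ ∘ T(π₁) + ι₂ ∘ μ_B ∘ T(π₂)` of a monad on a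
category with finite biproducts. -/
noncomputable def fusion (T : Monad C) (A B : C) :
    T.obj (A ⊞ T.obj B) ⟶ T.obj A ⊞ T.obj B :=
  badd (T.map biprod.fst ≫ biprod.inl) (T.map biprod.snd ≫ T.μ.app B ≫ biprod.inr)


/-- A *fusion invertor* for a monad `(T, μ, η)` on a category with finite biproducts:
a natural transformation `h°_A : T(A) ⟶ T(A ⊕ T(𝟘))` satisfying
[FI.1] `T(π₁) ∘ h°_A = 1`, [FI.2] `μ_𝟘 ∘ T(π₂) ∘ h°_A = 0`, and
[FI.3] `T(1_A ⊕ T(0)) ∘ h°_A ∘ T(π₁) + T(ι₂) ∘ η_{T(B)} ∘ μ_B ∘ T(π₂) = 1` for all `B`. -/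
structure FusionInvertor (T : Monad C) where
  /-- the component `h°_A : T(A) ⟶ T(A ⊕ T(𝟘))` -/
  app : ∀ A : C, T.obj A ⟶ T.obj (A ⊞ T.obj (0 : C))
  naturality : ∀ {A A' : C} (f : A ⟶ A'),
    T.map f ≫ app A' = app A ≫ T.map (biprod.map f (𝟙 (T.obj (0 : C))))
  fi1 : ∀ A : C, app A ≫ T.map biprod.fst = 𝟙 (T.obj A)
  fi2 : ∀ A : C, app A ≫ T.map biprod.snd ≫ T.μ.app (0 : C) = 0
  fi3 : ∀ A B : C,
    badd (T.map biprod.fst ≫ app A ≫ T.map (biprod.map (𝟙 A) (T.map (0 : (0 : C) ⟶ B))))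
        (T.map biprod.snd ≫ T.μ.app B ≫ T.η.app (T.obj B) ≫ T.map biprod.inr) =
      𝟙 (T.obj (A ⊞ T.obj B))

section

variable {D : Type*} [Category D] [HasZeroMorphisms D]

/-- A functor preserves zero maps as soon as it sends the zero object to a zero object. -/
lemma map_zero_of_id_eq_zero [HasZeroObject D] (F : D ⥤ D) (h : 𝟙 (F.obj (0 : D)) = 0) (A B : D) :
    F.map (0 : A ⟶ B) = 0 := by
  have e : (0 : A ⟶ B) = (0 : A ⟶ (0 : D)) ≫ (0 : (0 : D) ⟶ B) := by simp
  rw [e, F.map_comp, ← Category.id_comp (F.map (0 : (0 : D) ⟶ B)), h, zero_comp, comp_zero]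

lemma id_eq_zero_of_map_zero [HasZeroObject D] (F : D ⥤ D) (h : ∀ A B : D, F.map (0 : A ⟶ B) = 0) :
    𝟙 (F.obj (0 : D)) = 0 := by
  rw [← F.map_id, ← h 0 0, (isZero_zero D).eq_of_src (𝟙 (0 : D)) 0]

variable [HasBinaryBiproducts D]

lemma isIso_biprod_fst {A B : D} (h : IsZero B) : IsIso (biprod.fst : A ⊞ B ⟶ A) :=
  ⟨biprod.inl, by ext <;> first | exact h.eq_of_tgt _ _ | simp, by simp⟩

lemma isIso_biprod_snd {A B : D} (h : IsZero A) : IsIso (biprod.snd : A ⊞ B ⟶ B) :=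
  ⟨biprod.inr, by ext <;> first | exact h.eq_of_tgt _ _ | simp, by simp⟩

lemma badd_comp {X Y Z : D} (f g : X ⟶ Y) (k : Y ⟶ Z) :
    badd f g ≫ k = badd (f ≫ k) (g ≫ k) := by
  have e : biprod.desc (𝟙 Y) (𝟙 Y) ≫ k = biprod.map k k ≫ biprod.desc (𝟙 Z) (𝟙 Z) := by
    ext <;> simp
  have e' : biprod.lift f g ≫ biprod.map k k = biprod.lift (f ≫ k) (g ≫ k) := by
    ext <;> simp
  rw [badd, badd, Category.assoc, e, ← Category.assoc, e']

lemma zero_badd {X Y : D} (g : X ⟶ Y) : badd 0 g = g := by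
  have e : biprod.lift (0 : X ⟶ Y) g = g ≫ biprod.inr := by ext <;> simp
  simp [badd, e]

lemma fusion_snd (T : Monad D) (A B : D) :
    fusion T A B ≫ biprod.snd = T.map biprod.snd ≫ T.μ.app B := by
  simp [fusion, badd_comp, zero_badd]

end

/-- for a Hopf monad `(T, μ, η)` with fusion invertor `h°`, the
following are equivalent: (i) `T` is an idempotent monad; (ii) `T` preserves zero
maps; (iii) `h°_A = T(ι₁)` for every object `A`. -/
theorem idempotent_iff_map_zero_iff_fusionInvertor_eq (T : Monad C)
    [∀ A B : C, IsIso (fusion T A B)] (hc : FusionInvertor T) :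
    ((∀ A : C, IsIso (T.μ.app A)) ↔ (∀ A B : C, T.map (0 : A ⟶ B) = 0)) ∧
    ((∀ A B : C, T.map (0 : A ⟶ B) = 0) ↔
      (∀ A : C, hc.app A = T.map (biprod.inl : A ⟶ A ⊞ T.obj (0 : C)))) := by
  have to_zero : (∀ A : C, IsIso (T.μ.app A)) → ∀ A B : C, T.map (0 : A ⟶ B) = 0 := by
    intro hμ
    refine map_zero_of_id_eq_zero T.toFunctor ?_
    have := hμ 0
    have := isIso_biprod_snd (B := T.obj (0 : C)) (isZero_zero C)
    have h0 : hc.app 0 = 0 := by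
      rw [← cancel_mono (T.map biprod.snd ≫ T.μ.app (0 : C)), hc.fi2, zero_comp]
    rw [← hc.fi1, h0, zero_comp]
  refine ⟨⟨to_zero, fun h B => ?_⟩, fun h A => ?_, fun h => ?_⟩
  · have hz : IsZero (T.obj (0 : C)) :=
      (IsZero.iff_id_eq_zero _).2 (id_eq_zero_of_map_zero T.toFunctor h)
    have := isIso_biprod_snd (B := T.obj B) hz
    have := isIso_biprod_snd (B := T.obj B) (isZero_zero C)
    have : IsIso (T.map (biprod.snd : (0 : C) ⊞ T.obj B ⟶ _) ≫ T.μ.app B) := by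
      rw [← fusion_snd]
      infer_instance
    exact IsIso.of_isIso_comp_left (T.map (biprod.snd : (0 : C) ⊞ T.obj B ⟶ _)) _
  · have hz : IsZero (T.obj (0 : C)) :=
      (IsZero.iff_id_eq_zero _).2 (id_eq_zero_of_map_zero T.toFunctor h)
    have := isIso_biprod_fst (A := A) hz
    rw [← cancel_mono (T.map biprod.fst), hc.fi1, ← T.map_comp, biprod.inl_fst, T.map_id]
  · refine map_zero_of_id_eq_zero T.toFunctor ?_
    have e : T.η.app (0 : C) = (biprod.inl : _ ⟶ (0 : C) ⊞ T.obj (0 : C)) ≫ biprod.snd := (isZero_zero C).eq_of_src _ _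
    have h2 := hc.fi2 0
    rwa [h, ← Category.assoc, ← T.map_comp, ← e, T.right_unit] at h2

end HopfBiproducts
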